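/- arXiv:1104.2080 — 2 statements merged into one kernel-verified Lean document; each statement's English description precedes it below -/
import Mathlib

section
/- For every β > 0 and h ∈ ℝ, the limit α(β,h) := lim_{N→∞} α_N(β,h) exists and equals sup_{N≥1} α_N(β,h), and moreover lim_{N→∞} ( lim_{n→0⁺} φ_N(n,β,h) ) = α(β,h). -/
open MeasureTheory ProbabilityTheory Real Filter Topology

noncomputable section

/-- The ±1 spin value attached to a Boolean. -/
def spinVal (b : Bool) : ℝ := if b then 1 else -1

/-- Law of the couplings `J = (J_{ij})`: i.i.d. standard Gaussians. -/
def skMuJ (N : ℕ) : Measure (Fin N × Fin N → ℝ) :=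
  Measure.pi fun _ => gaussianReal 0 1

/-- The Sherrington–Kirkpatrick Hamiltonian. -/
def skH (N : ℕ) (h : ℝ) (J : Fin N × Fin N → ℝ) (σ : Fin N → Bool) : ℝ :=
  -(1 / Real.sqrt (N : ℝ)) *
      ∑ p ∈ Finset.univ.filter (fun p : Fin N × Fin N => p.1 < p.2),
        J p * spinVal (σ p.1) * spinVal (σ p.2)
    - h * ∑ i, spinVal (σ i)

/-- The SK partition function. -/
def skZ (N : ℕ) (β h : ℝ) (J : Fin N × Fin N → ℝ) : ℝ :=
  ∑ σ : Fin N → Bool, Real.exp (-β * skH N h J σ)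

/-- Quenched pressure `α_N(β,h) = N⁻¹ E log Z_N`. -/
def skAlpha (N : ℕ) (β h : ℝ) : ℝ :=
  (1 / (N : ℝ)) * ∫ J, Real.log (skZ N β h J) ∂ skMuJ N

/-- Interpolating function `φ_N(n,β,h) = (Nn)⁻¹ log E[Z_N^n]`. -/
def skPhi (N : ℕ) (n β h : ℝ) : ℝ :=
  (1 / ((N : ℝ) * n)) * Real.log (∫ J, skZ N β h J ^ n ∂ skMuJ N)

/-- The law of a family of i.i.d. standard Gaussians indexed by a finite type. -/
abbrev gaussianPi (P : Type*) [Fintype P] : Measure (P → ℝ) :=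
  Measure.pi fun _ => gaussianReal 0 1

lemma measurePreserving_pi_comp_injective {P Q : Type*} [Fintype P] [Fintype Q]
    {X : Type*} [MeasurableSpace X] (ν : Measure X) [IsProbabilityMeasure ν]
    {f : Q → P} (hf : Function.Injective f) :
    MeasurePreserving (fun J : P → X => fun q => J (f q))
      (Measure.pi fun _ => ν) (Measure.pi fun _ => ν) := by
  classical
  have hmeas : Measurable (fun J : P → X => fun q => J (f q)) := by fun_prop
  refine ⟨hmeas, (Measure.pi_eq fun s hs => ?_).symm⟩
  rw [Measure.map_apply hmeas (MeasurableSet.univ_pi hs)]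
  have hpre : (fun J : P → X => fun q => J (f q)) ⁻¹' Set.univ.pi s =
      ((Finset.univ.image f : Finset P) : Set P).pi
        (fun p => ⋂ (q : Q) (_ : f q = p), s q) := by
    ext J
    simp only [Set.mem_preimage, Set.mem_pi, Set.mem_univ, true_imp_iff, Finset.coe_image,
      Finset.coe_univ, Set.image_univ, Set.mem_range, Set.mem_iInter]
    constructor
    · rintro h _ ⟨q, rfl⟩ r hr
      rw [← hr]; exact h r
    · intro h q
      exact h (f q) ⟨q, rfl⟩ q rfl
  rw [hpre, Measure.pi_pi_finset, Finset.prod_image hf.injOn]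
  refine Finset.prod_congr rfl fun q _ => ?_
  congr 1
  ext x
  simp [hf.eq_iff]

lemma measurePreserving_pi_update {P : Type*} [Fintype P] [DecidableEq P]
    {X : Type*} [MeasurableSpace X] (ν : Measure X) [IsProbabilityMeasure ν] (p : P) :
    MeasurePreserving (fun y : (P → X) × X => Function.update y.1 p y.2)
      ((Measure.pi fun _ => ν).prod ν) (Measure.pi fun _ => ν) := by
  have hmeas : Measurable (fun y : (P → X) × X => Function.update y.1 p y.2) := by
    refine measurable_pi_iff.2 fun q => ?_
    by_cases h : q = p
    · subst h; simpa using measurable_snd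
    · simpa [h, Function.comp_def] using
        (measurable_pi_apply (X := fun _ : P => X) q).comp measurable_fst
  refine ⟨hmeas, (Measure.pi_eq fun s hs => ?_).symm⟩
  rw [Measure.map_apply hmeas (MeasurableSet.univ_pi hs)]
  have hpre : (fun y : (P → X) × X => Function.update y.1 p y.2) ⁻¹' Set.univ.pi s =
      (((Finset.univ.erase p : Finset P) : Set P).pi s) ×ˢ s p := by
    ext ⟨J, x⟩
    simp only [Set.mem_preimage, Set.mem_pi, Set.mem_univ, true_imp_iff, Set.mem_prod,
      Finset.coe_erase, Finset.coe_univ, Set.mem_sdiff, Set.mem_singleton_iff, true_and]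
    constructor
    · intro h
      exact ⟨fun q hq => by simpa [hq] using h q, by simpa using h p⟩
    · rintro ⟨h1, h2⟩ q
      by_cases h : q = p
      · subst h; simpa using h2
      · simpa [h] using h1 q h
  rw [hpre, Measure.prod_prod, Measure.pi_pi_finset]
  exact Finset.prod_erase_mul _ _ (Finset.mem_univ p)

lemma hasDerivAt_gaussianPDFReal_zero_one (x : ℝ) :
    HasDerivAt (gaussianPDFReal 0 1) (-x * gaussianPDFReal 0 1 x) x := by
  unfold gaussianPDFReal
  have h : HasDerivAt (fun x : ℝ => -(x - 0) ^ 2 / (2 * ((1 : NNReal) : ℝ))) (-x) x := by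
    have := ((((hasDerivAt_id x).sub_const 0).pow 2).neg).div_const (2 * ((1 : NNReal) : ℝ))
    refine this.congr_deriv ?_
    simp [neg_div]
  refine (h.exp.const_mul _).congr_deriv ?_
  ring

lemma integrable_gaussianReal_iff {f : ℝ → ℝ} :
    Integrable f (gaussianReal 0 1) ↔ Integrable (fun x => gaussianPDFReal 0 1 x * f x) := by
  rw [gaussianReal_of_var_ne_zero 0 one_ne_zero,
    integrable_withDensity_iff_integrable_smul₀' (measurable_gaussianPDF 0 1).aemeasurable
      (ae_of_all _ fun _ => gaussianPDF_lt_top)]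
  simp [toReal_gaussianPDF]

lemma integrable_id_gaussianReal : Integrable (fun x : ℝ => x) (gaussianReal 0 1) :=
  (memLp_id_gaussianReal 1).integrable le_rfl

/-- Gaussian integration by parts on the line. -/
lemma integral_id_mul_gaussianReal {g g' : ℝ → ℝ} {C : ℝ} (hg : ∀ x, HasDerivAt g (g' x) x)
    (hg'm : Measurable g') (hgC : ∀ x, |g x| ≤ C) (hg'C : ∀ x, |g' x| ≤ C) :
    ∫ x, x * g x ∂gaussianReal 0 1 = ∫ x, g' x ∂gaussianReal 0 1 := by
  have hgm : Measurable g :=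
    (continuous_iff_continuousAt.2 fun x => (hg x).continuousAt).measurable
  have i1 : Integrable g (gaussianReal 0 1) :=
    Integrable.of_bound hgm.aestronglyMeasurable C (ae_of_all _ hgC)
  have i2 : Integrable g' (gaussianReal 0 1) :=
    Integrable.of_bound hg'm.aestronglyMeasurable C (ae_of_all _ hg'C)
  have i3 : Integrable (fun x => x * g x) (gaussianReal 0 1) := by
    exact integrable_id_gaussianReal.mul_bdd hgm.aestronglyMeasurable (ae_of_all _ hgC)
  rw [integrable_gaussianReal_iff] at i1 i2 i3
  rw [integral_gaussianReal_eq_integral_smul one_ne_zero,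
    integral_gaussianReal_eq_integral_smul one_ne_zero]
  have := integral_mul_deriv_eq_deriv_mul_of_integrable
    (fun x _ => hasDerivAt_gaussianPDFReal_zero_one x) (fun x _ => hg x) i2
    (by refine i3.neg.congr (ae_of_all _ fun x => ?_); simp; ring) i1
  simp only [smul_eq_mul]
  rw [this, ← integral_neg]
  congr 1; ext x; ring

/-- Gaussian integration by parts in one coordinate of a standard Gaussian vector. -/
lemma integral_apply_mul_gaussianPi {P : Type*} [Fintype P] [DecidableEq P] (p : P)
    {G G' : (P → ℝ) → ℝ} {C : ℝ} (hG : Measurable G) (hG' : Measurable G')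
    (hd : ∀ J, HasDerivAt (fun x => G (Function.update J p x)) (G' J) (J p))
    (hGC : ∀ J, |G J| ≤ C) (hG'C : ∀ J, |G' J| ≤ C) :
    ∫ J, J p * G J ∂gaussianPi P = ∫ J, G' J ∂gaussianPi P := by
  have hup : MeasurePreserving (fun y : (P → ℝ) × ℝ => Function.update y.1 p y.2)
      ((gaussianPi P).prod (gaussianReal 0 1)) (gaussianPi P) :=
    measurePreserving_pi_update (gaussianReal 0 1) p
  have hi : Integrable (fun J : P → ℝ => J p * G J) (gaussianPi P) := by
    refine Integrable.mul_bdd (c := C) ?_ hG.aestronglyMeasurable (ae_of_all _ hGC)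
    exact (measurePreserving_eval (fun _ : P => gaussianReal 0 1) p).integrable_comp_of_integrable
      integrable_id_gaussianReal
  have hi' : Integrable G' (gaussianPi P) :=
    Integrable.of_bound hG'.aestronglyMeasurable C (ae_of_all _ hG'C)
  rw [← hup.map_eq, integral_map hup.aemeasurable, integral_map hup.aemeasurable,
    integral_prod, integral_prod]
  · congr 1; ext J
    simp only [Function.update_self]
    refine integral_id_mul_gaussianReal (C := C) (fun x => ?_) ?_ (fun x => hGC _)
      (fun x => hG'C _)
    · simpa using hd (Function.update J p x)
    · exact hG'.comp (measurable_update J)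
  · exact hup.integrable_comp_of_integrable hi'
  · exact hup.integrable_comp_of_integrable hi
  · rw [hup.map_eq]; exact hi'.aestronglyMeasurable
  · rw [hup.map_eq]; exact hi.aestronglyMeasurable

lemma integrable_apply_gaussianPi {P : Type*} [Fintype P] (p : P) :
    Integrable (fun J : P → ℝ => J p) (gaussianPi P) :=
  (measurePreserving_eval (fun _ : P => gaussianReal 0 1) p).integrable_comp_of_integrable
    integrable_id_gaussianReal

lemma integrable_exp_sum_abs_gaussianPi {P : Type*} [Fintype P] (t : ℝ) :
    Integrable (fun J : P → ℝ => rexp (t * ∑ p, |J p|)) (gaussianPi P) := by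
  simp only [Finset.mul_sum, Real.exp_sum]
  refine Integrable.fintype_prod (μ := fun _ : P => gaussianReal 0 1)
    (f := fun _ x => rexp (t * |x|)) fun _ => ?_
  exact integrable_exp_mul_abs (X := fun x : ℝ => x) (integrable_exp_mul_gaussianReal t)
    (integrable_exp_mul_gaussianReal (-t))

lemma integral_exp_sum_gaussianPi {P : Type*} [Fintype P] (a : P → ℝ) :
    ∫ J, rexp (∑ p, a p * J p) ∂gaussianPi P = rexp ((∑ p, a p ^ 2) / 2) := by
  simp only [Real.exp_sum, Finset.sum_div]
  have h := integral_fintype_prod_eq_prod (𝕜 := ℝ) (μ := fun _ : P => gaussianReal 0 1)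
    (fun p (x : ℝ) => rexp (a p * x))
  rw [h]
  refine Finset.prod_congr rfl fun p _ => ?_
  have := congrFun (mgf_fun_id_gaussianReal (μ := 0) (v := 1)) (a p)
  simpa [mgf] using this

/-- The partition function with a priori weights `w` and exponents `E`. -/
def expSum {S : Type*} [Fintype S] (w E : S → ℝ) : ℝ := ∑ σ, w σ * rexp (E σ)

/-- The Gibbs average of `f` with a priori weights `w` and exponents `E`. -/
def gibbs {S : Type*} [Fintype S] (w E f : S → ℝ) : ℝ :=
  (∑ σ, f σ * (w σ * rexp (E σ))) / expSum w E

section ExpSum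

variable {S : Type*} [Fintype S] {w : S → ℝ}

lemma expSum_pos [Nonempty S] (hw : ∀ σ, 0 < w σ) (E : S → ℝ) : 0 < expSum w E :=
  Finset.sum_pos (fun σ _ => mul_pos (hw σ) (exp_pos _)) Finset.univ_nonempty

lemma abs_gibbs_le [Nonempty S] (hw : ∀ σ, 0 < w σ) (E : S → ℝ) {f : S → ℝ} {M : ℝ}
    (hf : ∀ σ, |f σ| ≤ M) : |gibbs w E f| ≤ M := by
  have hZ := expSum_pos hw E
  rw [gibbs, abs_div, abs_of_pos hZ, div_le_iff₀ hZ, expSum, Finset.mul_sum]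
  refine (Finset.abs_sum_le_sum_abs _ _).trans (Finset.sum_le_sum fun σ _ => ?_)
  have h : 0 < w σ * rexp (E σ) := mul_pos (hw σ) (exp_pos _)
  rw [abs_mul, abs_of_pos h]
  exact mul_le_mul_of_nonneg_right (hf σ) h.le

lemma gibbs_sum_mul {ι : Type*} (s : Finset ι) (E : S → ℝ) (f : ι → S → ℝ) (x : ι → ℝ) :
    gibbs w E (fun σ => ∑ i ∈ s, f i σ * x i) = ∑ i ∈ s, x i * gibbs w E (f i) := by
  simp only [gibbs, Finset.sum_mul, mul_div_assoc', ← Finset.sum_div, Finset.mul_sum]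
  rw [Finset.sum_comm]
  congr 1
  refine Finset.sum_congr rfl fun i _ => Finset.sum_congr rfl fun σ _ => by ring

lemma hasDerivAt_sum_mul_exp {E : ℝ → S → ℝ} {E' : S → ℝ} {x : ℝ}
    (hE : ∀ σ, HasDerivAt (fun x => E x σ) (E' σ) x) (f : S → ℝ) :
    HasDerivAt (fun x => ∑ σ, f σ * (w σ * rexp (E x σ)))
      (∑ σ, f σ * E' σ * (w σ * rexp (E x σ))) x := by
  refine HasDerivAt.fun_sum fun σ _ => ?_
  refine (((hE σ).exp.const_mul (w σ)).const_mul (f σ)).congr_deriv ?_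
  ring

lemma hasDerivAt_expSum {E : ℝ → S → ℝ} {E' : S → ℝ} {x : ℝ}
    (hE : ∀ σ, HasDerivAt (fun x => E x σ) (E' σ) x) :
    HasDerivAt (fun x => expSum w (E x)) (∑ σ, E' σ * (w σ * rexp (E x σ))) x := by
  simpa [expSum] using hasDerivAt_sum_mul_exp (w := w) hE (fun _ => 1)

lemma hasDerivAt_log_expSum [Nonempty S] (hw : ∀ σ, 0 < w σ) {E : ℝ → S → ℝ} {E' : S → ℝ} {x : ℝ}
    (hE : ∀ σ, HasDerivAt (fun x => E x σ) (E' σ) x) :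
    HasDerivAt (fun x => log (expSum w (E x))) (gibbs w (E x) E') x :=
  (hasDerivAt_expSum hE).log (expSum_pos hw _).ne'

lemma hasDerivAt_gibbs [Nonempty S] (hw : ∀ σ, 0 < w σ) {E : ℝ → S → ℝ} {E' : S → ℝ} {x : ℝ}
    (hE : ∀ σ, HasDerivAt (fun x => E x σ) (E' σ) x) (f : S → ℝ) :
    HasDerivAt (fun x => gibbs w (E x) f)
      (gibbs w (E x) (fun σ => f σ * E' σ) - gibbs w (E x) f * gibbs w (E x) E') x := by
  have hZ := (expSum_pos hw (E x)).ne'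
  refine ((hasDerivAt_sum_mul_exp hE f).div (hasDerivAt_expSum hE) hZ).congr_deriv ?_
  simp only [gibbs]
  field_simp

lemma abs_log_expSum_sub_le [Nonempty S] (hw : ∀ σ, 0 < w σ) {E : S → ℝ} {B : ℝ}
    (hE : ∀ σ, |E σ| ≤ B) : |log (expSum w E) - log (expSum w 0)| ≤ B := by
  have h0 := expSum_pos hw 0
  have hZ := expSum_pos hw E
  have hup : expSum w E ≤ rexp B * expSum w 0 := by
    rw [expSum, expSum, Finset.mul_sum]
    refine Finset.sum_le_sum fun σ _ => ?_
    have := mul_le_mul_of_nonneg_left (exp_le_exp.2 (le_of_abs_le (hE σ))) (hw σ).le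
    simpa [mul_comm] using this
  have hlo : rexp (-B) * expSum w 0 ≤ expSum w E := by
    rw [expSum, expSum, Finset.mul_sum]
    refine Finset.sum_le_sum fun σ _ => ?_
    have := mul_le_mul_of_nonneg_left (exp_le_exp.2 (neg_le_of_abs_le (hE σ))) (hw σ).le
    simpa [mul_comm] using this
  have h1 := log_le_log hZ hup
  have h2 := log_le_log (by positivity) hlo
  rw [log_mul (exp_pos _).ne' h0.ne', log_exp] at h1 h2
  rw [abs_le]
  constructor <;> linarith

/-- A sum of Gibbs covariances is nonnegative if its kernel is largest on the diagonal. -/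
lemma sum_gibbs_cov_nonneg [Nonempty S] {P : Type*} [Fintype P] (hw : ∀ σ, 0 < w σ) (E : S → ℝ)
    (c c' : S → P → ℝ)
    (hK : ∀ σ τ, ∑ p, c' σ p * c τ p ≤ ∑ p, c' σ p * c σ p) :
    0 ≤ ∑ p, (gibbs w E (fun σ => c' σ p * c σ p)
      - gibbs w E (fun σ => c' σ p) * gibbs w E (fun σ => c σ p)) := by
  have hZ := expSum_pos hw E
  have key : ∑ p, (gibbs w E (fun σ => c' σ p * c σ p)
      - gibbs w E (fun σ => c' σ p) * gibbs w E (fun σ => c σ p)) =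
      (∑ σ, ∑ τ, (w σ * rexp (E σ)) * (w τ * rexp (E τ)) *
        (∑ p, c' σ p * c σ p - ∑ p, c' σ p * c τ p)) / (expSum w E) ^ 2 := by
    rw [eq_div_iff (by positivity), Finset.sum_mul]
    have hp : ∀ p, (gibbs w E (fun σ => c' σ p * c σ p)
      - gibbs w E (fun σ => c' σ p) * gibbs w E (fun σ => c σ p)) * expSum w E ^ 2 =
      ∑ σ, ∑ τ, (w σ * rexp (E σ)) * (w τ * rexp (E τ)) * (c' σ p * c σ p - c' σ p * c τ p) := by
      intro p
      trans (∑ σ, c' σ p * c σ p * (w σ * rexp (E σ))) * (∑ τ, w τ * rexp (E τ))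
        - (∑ σ, c' σ p * (w σ * rexp (E σ))) * (∑ τ, c τ p * (w τ * rexp (E τ)))
      · change _ = _ * expSum w E - _
        simp only [gibbs]
        field_simp
      · simp only [Finset.sum_mul_sum, ← Finset.sum_sub_distrib]
        exact Finset.sum_congr rfl fun σ _ => Finset.sum_congr rfl fun τ _ => by ring
    simp only [hp, ← Finset.sum_sub_distrib, Finset.mul_sum]
    rw [Finset.sum_comm]
    exact Finset.sum_congr rfl fun σ _ => Finset.sum_comm
  rw [key]
  refine div_nonneg (Finset.sum_nonneg fun σ _ => Finset.sum_nonneg fun τ _ => ?_) (sq_nonneg _)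
  exact mul_nonneg (mul_pos (mul_pos (hw σ) (exp_pos _)) (mul_pos (hw τ) (exp_pos _))).le
    (sub_nonneg.2 (hK σ τ))

lemma continuous_expSum : Continuous (expSum w) := by
  unfold expSum; fun_prop

lemma continuous_gibbs [Nonempty S] (hw : ∀ σ, 0 < w σ) (f : S → ℝ) :
    Continuous (fun E => gibbs w E f) := by
  unfold gibbs
  exact Continuous.div (by fun_prop) continuous_expSum fun E => (expSum_pos hw E).ne'

lemma continuous_log_expSum [Nonempty S] (hw : ∀ σ, 0 < w σ) :
    Continuous (fun E => log (expSum w E)) :=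
  continuous_expSum.log fun E => (expSum_pos hw E).ne'

end ExpSum

/-- The linear forms in `J` with coefficients `c σ`. -/
def linForm {S P : Type*} [Fintype P] (c : S → P → ℝ) (J : P → ℝ) : S → ℝ :=
  fun σ => ∑ p, c σ p * J p

lemma continuous_linForm {S P : Type*} [Fintype P] (c : S → P → ℝ) : Continuous (linForm c) := by
  unfold linForm; fun_prop

lemma abs_linForm_le {S P : Type*} [Fintype P] {c : S → P → ℝ} {M : ℝ}
    (hc : ∀ σ p, |c σ p| ≤ M) (J : P → ℝ) (σ : S) :
    |linForm c J σ| ≤ M * ∑ p, |J p| := by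
  rw [linForm, Finset.mul_sum]
  refine (Finset.abs_sum_le_sum_abs _ _).trans (Finset.sum_le_sum fun p _ => ?_)
  rw [abs_mul]
  exact mul_le_mul_of_nonneg_right (hc σ p) (abs_nonneg _)

section LinForm

variable {S P : Type*} [Fintype S] [Fintype P] {w : S → ℝ}

lemma exists_forall_abs_le (c : S → P → ℝ) : ∃ M, 0 ≤ M ∧ ∀ σ p, |c σ p| ≤ M := by
  refine ⟨∑ σ, ∑ p, |c σ p|, by positivity, fun σ p => ?_⟩
  refine (Finset.single_le_sum (f := fun p => |c σ p|) (fun p _ => abs_nonneg _)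
    (Finset.mem_univ p)).trans ?_
  exact Finset.single_le_sum (f := fun σ => ∑ p, |c σ p|)
    (fun σ _ => Finset.sum_nonneg fun p _ => abs_nonneg _) (Finset.mem_univ σ)

lemma abs_log_expSum_linForm_le [Nonempty S] (hw : ∀ σ, 0 < w σ) {c : S → P → ℝ} {M : ℝ}
    (hc : ∀ σ p, |c σ p| ≤ M) (J : P → ℝ) :
    |log (expSum w (linForm c J))| ≤ |log (expSum w 0)| + M * ∑ p, |J p| := by
  have h1 := abs_log_expSum_sub_le hw (abs_linForm_le hc J)
  have h2 := abs_sub_abs_le_abs_sub (log (expSum w (linForm c J))) (log (expSum w 0))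
  linarith

lemma integrable_sum_abs_gaussianPi :
    Integrable (fun J : P → ℝ => ∑ p, |J p|) (gaussianPi P) :=
  integrable_finsetSum _ fun p _ => (integrable_apply_gaussianPi p).abs

lemma aestronglyMeasurable_log_expSum_linForm [Nonempty S] (hw : ∀ σ, 0 < w σ) (c : S → P → ℝ) :
    AEStronglyMeasurable (fun J => log (expSum w (linForm c J))) (gaussianPi P) :=
  ((continuous_log_expSum hw).comp (continuous_linForm c)).aestronglyMeasurable

lemma integrable_log_expSum_linForm [Nonempty S] (hw : ∀ σ, 0 < w σ) (c : S → P → ℝ) :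
    Integrable (fun J => log (expSum w (linForm c J))) (gaussianPi P) := by
  obtain ⟨M, -, hM⟩ := exists_forall_abs_le c
  exact ((integrable_const _).add (integrable_sum_abs_gaussianPi.const_mul M)).mono'
    (aestronglyMeasurable_log_expSum_linForm hw c)
    (ae_of_all _ fun J => abs_log_expSum_linForm_le hw hM J)

lemma integrable_exp_mul_log_expSum_linForm [Nonempty S] (hw : ∀ σ, 0 < w σ) (c : S → P → ℝ)
    (t : ℝ) : Integrable (fun J => rexp (t * log (expSum w (linForm c J)))) (gaussianPi P) := by
  obtain ⟨M, -, hM⟩ := exists_forall_abs_le c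
  refine ((integrable_exp_sum_abs_gaussianPi (|t| * M)).const_mul
    (rexp (|t| * |log (expSum w 0)|))).mono'
    (continuous_exp.comp_aestronglyMeasurable
      ((aestronglyMeasurable_log_expSum_linForm hw c).const_mul t)) (ae_of_all _ fun J => ?_)
  rw [Real.norm_eq_abs, abs_exp, ← exp_add, exp_le_exp]
  calc t * log (expSum w (linForm c J))
      ≤ |t| * |log (expSum w (linForm c J))| := by rw [← abs_mul]; exact le_abs_self _
    _ ≤ |t| * (|log (expSum w 0)| + M * ∑ p, |J p|) :=
        mul_le_mul_of_nonneg_left (abs_log_expSum_linForm_le hw hM J) (abs_nonneg t)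
    _ = _ := by ring

lemma integral_apply_mul_gibbs [Nonempty S] [DecidableEq P] (hw : ∀ σ, 0 < w σ) (c : S → P → ℝ)
    (f : S → ℝ) (p : P) :
    ∫ J, J p * gibbs w (linForm c J) f ∂gaussianPi P =
      ∫ J, (gibbs w (linForm c J) (fun σ => f σ * c σ p)
        - gibbs w (linForm c J) f * gibbs w (linForm c J) (fun σ => c σ p)) ∂gaussianPi P := by
  obtain ⟨M, hM0, hM⟩ := exists_forall_abs_le c
  obtain ⟨A, hA0, hA'⟩ := exists_forall_abs_le (fun σ (_ : Unit) => f σ)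
  have hA : ∀ σ, |f σ| ≤ A := fun σ => hA' σ ()
  have hm : ∀ g : S → ℝ, Measurable (fun J => gibbs w (linForm c J) g) := fun g =>
    ((continuous_gibbs hw g).comp (continuous_linForm c)).measurable
  have hfc : ∀ E, |gibbs w E (fun σ => f σ * c σ p)| ≤ A * M := fun E =>
    abs_gibbs_le hw E fun σ => by
      rw [abs_mul]; exact mul_le_mul (hA σ) (hM σ p) (abs_nonneg _) hA0
  refine integral_apply_mul_gaussianPi p (C := A + 2 * (A * M)) (hm f)
    ((hm _).sub ((hm _).mul (hm _))) (fun J => ?_) (fun J => ?_) (fun J => ?_)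
  · have hd : ∀ σ, HasDerivAt (fun x => linForm c (Function.update J p x) σ) (c σ p) (J p) := by
      intro σ
      unfold linForm
      have : HasDerivAt (fun x => ∑ q, c σ q * Function.update J p x q)
          (∑ q, c σ q * (Pi.single p 1 : P → ℝ) q) (J p) :=
        HasDerivAt.fun_sum fun q _ =>
          (hasDerivAt_pi.1 (hasDerivAt_update J p (J p)) q).const_mul (c σ q)
      simpa [Pi.single_apply] using this
    have := hasDerivAt_gibbs hw hd f
    simpa using this
  · have := abs_gibbs_le hw (linForm c J) hA
    have : 0 ≤ A * M := by positivity
    linarith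
  · have h1 := abs_gibbs_le hw (linForm c J) hA
    have h2 := abs_gibbs_le hw (linForm c J) (fun σ => hM σ p)
    refine (abs_sub _ _).trans ?_
    rw [abs_mul]
    have := mul_le_mul h1 h2 (abs_nonneg _) hA0
    have := hfc (linForm c J)
    linarith

lemma exists_hasDerivAt_integral_log_expSum [Nonempty S] (hw : ∀ σ, 0 < w σ)
    {c c' : ℝ → S → P → ℝ} {M : ℝ}
    (hc : ∀ θ σ p, HasDerivAt (fun θ => c θ σ p) (c' θ σ p) θ)
    (hM : ∀ θ σ p, |c' θ σ p| ≤ M) (θ : ℝ)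
    (hK : ∀ σ τ, ∑ p, c' θ σ p * c θ τ p ≤ ∑ p, c' θ σ p * c θ σ p) :
    ∃ d, 0 ≤ d ∧
      HasDerivAt (fun θ => ∫ J, log (expSum w (linForm (c θ) J)) ∂gaussianPi P) d θ := by
  classical
  have hm : ∀ g : S → ℝ, Continuous (fun J => gibbs w (linForm (c θ) J) g) := fun g =>
    (continuous_gibbs hw g).comp (continuous_linForm (c θ))
  have hexp : ∀ θ J, gibbs w (linForm (c θ) J) (linForm (c' θ) J) =
      ∑ p, J p * gibbs w (linForm (c θ) J) (fun σ => c' θ σ p) := fun θ J =>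
    gibbs_sum_mul Finset.univ _ (fun p σ => c' θ σ p) J
  have key := (hasDerivAt_integral_of_dominated_loc_of_deriv_le (μ := gaussianPi P)
    (F := fun θ J => log (expSum w (linForm (c θ) J)))
    (F' := fun θ J => gibbs w (linForm (c θ) J) (linForm (c' θ) J))
    (bound := fun J => M * ∑ p, |J p|) (x₀ := θ) univ_mem
    (.of_forall fun θ => aestronglyMeasurable_log_expSum_linForm hw (c θ))
    (integrable_log_expSum_linForm hw (c θ))
    (by
      simp only [hexp]
      exact (continuous_finsetSum _ fun p _ =>
        (continuous_apply p).mul (hm _)).aestronglyMeasurable)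
    (ae_of_all _ fun J θ _ => abs_gibbs_le hw _ (abs_linForm_le (hM θ) J))
    (integrable_sum_abs_gaussianPi.const_mul M)
    (ae_of_all _ fun J θ _ => hasDerivAt_log_expSum hw fun σ =>
      HasDerivAt.fun_sum fun p _ => (hc θ σ p).mul_const (J p))).2
  refine ⟨_, ?_, key⟩
  have hb : ∀ g : S → ℝ, ∃ C, ∀ J, |gibbs w (linForm (c θ) J) g| ≤ C := fun g => by
    obtain ⟨A, -, hA⟩ := exists_forall_abs_le (fun σ (_ : Unit) => g σ)
    exact ⟨A, fun J => abs_gibbs_le hw _ fun σ => hA σ ()⟩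
  have hi : ∀ g : S → ℝ, Integrable (fun J => gibbs w (linForm (c θ) J) g) (gaussianPi P) :=
    fun g => by
      obtain ⟨C, hC⟩ := hb g
      exact Integrable.of_bound (hm g).aestronglyMeasurable C (ae_of_all _ hC)
  simp only [hexp]
  rw [integral_finsetSum _ fun p _ => ?_]
  · simp only [integral_apply_mul_gibbs hw]
    rw [← integral_finsetSum _ fun p _ => ?_]
    · exact integral_nonneg fun J => sum_gibbs_cov_nonneg hw _ _ _ hK
    · obtain ⟨C, hC⟩ := hb (fun σ => c θ σ p)
      exact (hi _).sub ((hi _).mul_bdd (hm _).aestronglyMeasurable (ae_of_all _ hC))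
  · obtain ⟨C, hC⟩ := hb (fun σ => c' θ σ p)
    exact (integrable_apply_gaussianPi p).mul_bdd (hm _).aestronglyMeasurable (ae_of_all _ hC)

lemma integral_log_expSum_linForm_comp_injective {Q : Type*} [Fintype Q] [Nonempty S]
    (hw : ∀ σ, 0 < w σ) (b : S → Q → ℝ) {f : Q → P} (hf : Function.Injective f) :
    ∫ J, log (expSum w (linForm b (fun q => J (f q)))) ∂gaussianPi P =
      ∫ J, log (expSum w (linForm b J)) ∂gaussianPi Q := by
  have h : MeasurePreserving (fun J : P → ℝ => fun q => J (f q)) (gaussianPi P) (gaussianPi Q) :=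
    measurePreserving_pi_comp_injective (gaussianReal 0 1) hf
  rw [← h.map_eq, integral_map h.aemeasurable]
  rw [h.map_eq]
  exact aestronglyMeasurable_log_expSum_linForm hw b

/-- Gaussian comparison: among two families of centered Gaussian exponents, the one with
smaller covariances relative to its variances has the larger expected log-partition function. -/
theorem integral_log_expSum_le_of_cov_le {Q : Type*} [Fintype Q] [Nonempty S]
    (hw : ∀ σ, 0 < w σ) (a : S → P → ℝ) (b : S → Q → ℝ)
    (hab : ∀ σ τ, ∑ p, a σ p * a τ p - ∑ q, b σ q * b τ q ≤
      ∑ p, a σ p * a σ p - ∑ q, b σ q * b σ q) :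
    ∫ J, log (expSum w (linForm b J)) ∂gaussianPi Q ≤
      ∫ J, log (expSum w (linForm a J)) ∂gaussianPi P := by
  obtain ⟨A, hA0, hA⟩ := exists_forall_abs_le a
  obtain ⟨B, hB0, hB⟩ := exists_forall_abs_le b
  let c : ℝ → S → P ⊕ Q → ℝ := fun θ σ =>
    Sum.elim (fun p => sin θ * a σ p) (fun q => cos θ * b σ q)
  let c' : ℝ → S → P ⊕ Q → ℝ := fun θ σ =>
    Sum.elim (fun p => cos θ * a σ p) (fun q => -sin θ * b σ q)
  have hc : ∀ θ σ p, HasDerivAt (fun θ => c θ σ p) (c' θ σ p) θ := by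
    rintro θ σ (p | q)
    · exact (hasDerivAt_sin θ).mul_const _
    · exact (hasDerivAt_cos θ).mul_const _
  have hM : ∀ θ σ p, |c' θ σ p| ≤ A + B := by
    rintro θ σ (p | q)
    · simp only [c', Sum.elim_inl, abs_mul]
      have := mul_le_mul (abs_cos_le_one θ) (hA σ p) (abs_nonneg _) zero_le_one
      linarith
    · simp only [c', Sum.elim_inr, abs_mul, abs_neg]
      have := mul_le_mul (abs_sin_le_one θ) (hB σ q) (abs_nonneg _) zero_le_one
      linarith
  have hcov : ∀ θ σ τ, ∑ p, c' θ σ p * c θ τ p =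
      sin θ * cos θ * (∑ p, a σ p * a τ p - ∑ q, b σ q * b τ q) := by
    intro θ σ τ
    simp only [c, c', Fintype.sum_sum_type, Sum.elim_inl, Sum.elim_inr]
    rw [mul_sub, sub_eq_add_neg, Finset.mul_sum, Finset.mul_sum, ← Finset.sum_neg_distrib]
    congr 1 <;> exact Finset.sum_congr rfl fun p _ => by ring
  have hder : ∀ θ, θ ∈ Set.Icc 0 (π / 2) → ∃ d, 0 ≤ d ∧ HasDerivAt
      (fun θ => ∫ J, log (expSum w (linForm (c θ) J)) ∂gaussianPi (P ⊕ Q)) d θ := by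
    intro θ hθ
    refine exists_hasDerivAt_integral_log_expSum hw hc hM θ fun σ τ => ?_
    rw [hcov, hcov]
    refine mul_le_mul_of_nonneg_left (hab σ τ) (mul_nonneg ?_ ?_)
    · exact sin_nonneg_of_nonneg_of_le_pi hθ.1 (by linarith [hθ.2, pi_pos])
    · exact cos_nonneg_of_neg_pi_div_two_le_of_le (by linarith [hθ.1, pi_pos]) hθ.2
  have hpi : (0 : ℝ) ≤ π / 2 := by positivity
  have hmono := monotoneOn_of_deriv_nonneg (convex_Icc (0 : ℝ) (π / 2))
    (fun θ hθ => let ⟨_, _, h⟩ := hder θ hθ; h.continuousAt.continuousWithinAt)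
    (fun θ hθ => let ⟨_, _, h⟩ := hder θ (interior_subset hθ)
      h.differentiableAt.differentiableWithinAt)
    (fun θ hθ => let ⟨_, h0, h⟩ := hder θ (interior_subset hθ); h.deriv ▸ h0)
    (Set.left_mem_Icc.2 hpi) (Set.right_mem_Icc.2 hpi) hpi
  have h0 : ∀ J, linForm (c 0) J = linForm b (fun q => J (Sum.inr q)) := fun J => by
    ext σ; simp [linForm, c]
  have h1 : ∀ J, linForm (c (π / 2)) J = linForm a (fun p => J (Sum.inl p)) := fun J => by
    ext σ; simp [linForm, c]
  simp only [h0, h1] at hmono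
  rwa [integral_log_expSum_linForm_comp_injective hw b Sum.inr_injective,
    integral_log_expSum_linForm_comp_injective hw a Sum.inl_injective] at hmono

end LinForm

lemma spinVal_mul_self (b : Bool) : spinVal b * spinVal b = 1 := by
  cases b <;> simp [spinVal]

lemma abs_spinVal (b : Bool) : |spinVal b| = 1 := by
  cases b <;> simp [spinVal]

/-- The a priori weights of the SK model. -/
def skWeight (N : ℕ) (β h : ℝ) (σ : Fin N → Bool) : ℝ := rexp (β * h * ∑ i, spinVal (σ i))

/-- The coefficients of the couplings in the SK exponent. -/
def skCoeff (N : ℕ) (β : ℝ) (σ : Fin N → Bool) (p : Fin N × Fin N) : ℝ :=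
  if p.1 < p.2 then β / √N * (spinVal (σ p.1) * spinVal (σ p.2)) else 0

lemma skWeight_pos (N : ℕ) (β h : ℝ) (σ : Fin N → Bool) : 0 < skWeight N β h σ := exp_pos _

lemma skZ_eq_expSum (N : ℕ) (β h : ℝ) (J : Fin N × Fin N → ℝ) :
    skZ N β h J = expSum (skWeight N β h) (linForm (skCoeff N β) J) := by
  unfold skZ expSum skWeight linForm skCoeff skH
  refine Finset.sum_congr rfl fun σ _ => ?_
  rw [← exp_add]
  congr 1
  simp only [ite_mul, zero_mul, ← Finset.sum_filter]
  rw [mul_sub, Finset.mul_sum, Finset.mul_sum, sub_eq_add_neg, add_comm]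
  congr 1
  · ring
  · exact Finset.sum_congr rfl fun p _ => by ring

lemma two_mul_sum_lt_mul {N : ℕ} (x : Fin N → ℝ) :
    2 * ∑ p : Fin N × Fin N, (if p.1 < p.2 then x p.1 * x p.2 else 0) =
      (∑ i, x i) ^ 2 - ∑ i, x i * x i := by
  have hsq : (∑ i, x i) ^ 2 = ∑ p : Fin N × Fin N, x p.1 * x p.2 := by
    rw [sq, Finset.sum_mul_sum, Fintype.sum_prod_type]
  have hdiag : ∑ i, x i * x i =
      ∑ p : Fin N × Fin N, (if p.1 = p.2 then x p.1 * x p.2 else 0) := by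
    simp [Fintype.sum_prod_type]
  have hswap : ∑ p : Fin N × Fin N, (if p.2 < p.1 then x p.1 * x p.2 else 0) =
      ∑ p : Fin N × Fin N, (if p.1 < p.2 then x p.1 * x p.2 else 0) :=
    Fintype.sum_equiv (Equiv.prodComm _ _) _ _ fun p => by simp [mul_comm]
  rw [two_mul]
  nth_rw 2 [← hswap]
  rw [hsq, hdiag, ← Finset.sum_add_distrib, ← Finset.sum_sub_distrib]
  refine Finset.sum_congr rfl fun p _ => ?_
  rcases lt_trichotomy p.1 p.2 with h | h | h
  · simp [h, h.not_gt, h.ne]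
  · simp [h]
  · simp [h, h.not_gt, h.ne']

lemma sum_skCoeff_mul {N : ℕ} (hN : N ≠ 0) (β : ℝ) (σ τ : Fin N → Bool) :
    ∑ p, skCoeff N β σ p * skCoeff N β τ p =
      β ^ 2 / 2 * ((∑ i, spinVal (σ i) * spinVal (τ i)) ^ 2 / N - 1) := by
  have hN' : (N : ℝ) ≠ 0 := Nat.cast_ne_zero.2 hN
  have h := two_mul_sum_lt_mul fun i => spinVal (σ i) * spinVal (τ i)
  have h1 : ∑ i, spinVal (σ i) * spinVal (τ i) * (spinVal (σ i) * spinVal (τ i)) = N := by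
    simp [mul_mul_mul_comm, spinVal_mul_self]
  rw [h1] at h
  have h2 : ∑ p, skCoeff N β σ p * skCoeff N β τ p = β ^ 2 / N *
      ∑ p : Fin N × Fin N, (if p.1 < p.2 then
        spinVal (σ p.1) * spinVal (τ p.1) * (spinVal (σ p.2) * spinVal (τ p.2)) else 0) := by
    rw [Finset.mul_sum]
    refine Finset.sum_congr rfl fun p _ => ?_
    unfold skCoeff
    split_ifs
    · have : β ^ 2 / N = β / √N * (β / √N) := by
        rw [div_mul_div_comm, Real.mul_self_sqrt (Nat.cast_nonneg N), sq]
      rw [this]; ring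
    · simp
  rw [h2, eq_div_of_mul_eq two_ne_zero ((mul_comm _ _).trans h)]
  field_simp

lemma sum_skCoeff_sq_le (N : ℕ) (β : ℝ) (σ : Fin N → Bool) :
    ∑ p, skCoeff N β σ p ^ 2 ≤ β ^ 2 * N := by
  rcases eq_or_ne N 0 with rfl | hN
  · simp
  have h := sum_skCoeff_mul hN β σ σ
  simp only [spinVal_mul_self, Finset.sum_const, Finset.card_univ, Fintype.card_fin,
    nsmul_eq_mul, mul_one] at h
  simp only [sq (skCoeff N β σ _), h]
  have hN' : (N : ℝ) ≠ 0 := Nat.cast_ne_zero.2 hN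
  rw [sq (N : ℝ), mul_div_assoc, div_self hN']
  nlinarith [sq_nonneg β, Nat.cast_nonneg (α := ℝ) N,
    mul_nonneg (sq_nonneg β) (Nat.cast_nonneg (α := ℝ) N)]

lemma skWeight_append {m n : ℕ} (β h : ℝ) (σ : Fin m → Bool) (τ : Fin n → Bool) :
    skWeight (m + n) β h (Fin.append σ τ) = skWeight m β h σ * skWeight n β h τ := by
  simp [skWeight, Fin.sum_univ_add, ← exp_add, mul_add]

/-- The coefficients of the couplings of two non-interacting SK systems. -/
def skCoeffSplit (m n : ℕ) (β : ℝ) (σ : Fin (m + n) → Bool) :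
    (Fin m × Fin m) ⊕ (Fin n × Fin n) → ℝ :=
  Sum.elim (skCoeff m β fun i => σ (Fin.castAdd n i)) (skCoeff n β fun i => σ (Fin.natAdd m i))

lemma expSum_skCoeffSplit (m n : ℕ) (β h : ℝ) (J : (Fin m × Fin m) ⊕ (Fin n × Fin n) → ℝ) :
    expSum (skWeight (m + n) β h) (linForm (skCoeffSplit m n β) J) =
      expSum (skWeight m β h) (linForm (skCoeff m β) fun p => J (Sum.inl p)) *
        expSum (skWeight n β h) (linForm (skCoeff n β) fun p => J (Sum.inr p)) := by
  simp only [expSum]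
  rw [Finset.sum_mul_sum, ← Fintype.sum_prod_type', ← (Fin.appendEquiv m n).sum_comp]
  refine Finset.sum_congr rfl fun x _ => ?_
  simp [Fin.appendEquiv, skWeight_append, linForm, skCoeffSplit, exp_add]
  ring

lemma integral_log_skZ (N : ℕ) (β h : ℝ) :
    ∫ J, log (skZ N β h J) ∂skMuJ N =
      ∫ J, log (expSum (skWeight N β h) (linForm (skCoeff N β) J))
        ∂gaussianPi (Fin N × Fin N) := by
  simp only [skZ_eq_expSum, skMuJ]

lemma add_sq_div_add_le {a b x y : ℝ} (hx : 0 < x) (hy : 0 < y) :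
    (a + b) ^ 2 / (x + y) ≤ a ^ 2 / x + b ^ 2 / y := by
  rw [div_add_div _ _ hx.ne' hy.ne', div_le_div_iff₀ (by positivity) (by positivity)]
  nlinarith [sq_nonneg (a * y - b * x), mul_pos hx hy]

/-- Superadditivity of the mean log-partition function. -/
lemma integral_log_skZ_add_le {m n : ℕ} (hm : m ≠ 0) (hn : n ≠ 0) (β h : ℝ) :
    ∫ J, log (skZ m β h J) ∂skMuJ m + ∫ J, log (skZ n β h J) ∂skMuJ n ≤
      ∫ J, log (skZ (m + n) β h J) ∂skMuJ (m + n) := by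
  have hwm := skWeight_pos m β h
  have hwn := skWeight_pos n β h
  have hsplit : ∫ J, log (expSum (skWeight (m + n) β h) (linForm (skCoeffSplit m n β) J))
      ∂gaussianPi ((Fin m × Fin m) ⊕ (Fin n × Fin n)) =
      ∫ J, log (skZ m β h J) ∂skMuJ m + ∫ J, log (skZ n β h J) ∂skMuJ n := by
    simp only [expSum_skCoeffSplit, integral_log_skZ,
      log_mul (expSum_pos hwm _).ne' (expSum_pos hwn _).ne']
    rw [integral_add, integral_log_expSum_linForm_comp_injective hwm _ Sum.inl_injective,
      integral_log_expSum_linForm_comp_injective hwn _ Sum.inr_injective]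
    · exact (measurePreserving_pi_comp_injective (gaussianReal 0 1)
        Sum.inl_injective).integrable_comp_of_integrable
          (integrable_log_expSum_linForm hwm (skCoeff m β))
    · exact (measurePreserving_pi_comp_injective (gaussianReal 0 1)
        Sum.inr_injective).integrable_comp_of_integrable
          (integrable_log_expSum_linForm hwn (skCoeff n β))
  rw [← hsplit, integral_log_skZ]
  refine integral_log_expSum_le_of_cov_le (skWeight_pos _ β h) _ _ fun σ τ => ?_
  have hm' : (0 : ℝ) < m := Nat.cast_pos.2 (Nat.pos_of_ne_zero hm)
  have hn' : (0 : ℝ) < n := Nat.cast_pos.2 (Nat.pos_of_ne_zero hn)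
  have hq : ∀ k : ℝ, 0 < k → k ^ 2 / k = k := fun k hk => by field_simp
  simp only [skCoeffSplit, Fintype.sum_sum_type, Sum.elim_inl, Sum.elim_inr,
    sum_skCoeff_mul hm, sum_skCoeff_mul hn, sum_skCoeff_mul (N := m + n) (by omega),
    Fin.sum_univ_add, Nat.cast_add, spinVal_mul_self, Finset.sum_const, Finset.card_univ,
    Fintype.card_fin, nsmul_eq_mul, mul_one, hq _ hm', hq _ hn', hq _ (add_pos hm' hn')]
  have hs := mul_le_mul_of_nonneg_left (add_sq_div_add_le
    (a := ∑ i, spinVal (σ (Fin.castAdd n i)) * spinVal (τ (Fin.castAdd n i)))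
    (b := ∑ i, spinVal (σ (Fin.natAdd m i)) * spinVal (τ (Fin.natAdd m i))) hm' hn')
    (by positivity : 0 ≤ β ^ 2 / 2)
  linarith

lemma integral_log_skZ_le (N : ℕ) (β h : ℝ) :
    ∫ J, log (skZ N β h J) ∂skMuJ N ≤ (log 2 + |β * h| + β ^ 2 / 2) * N := by
  have hw := skWeight_pos N β h
  set K := (log 2 + |β * h| + β ^ 2 / 2) * N with hK
  have hterm : ∀ σ, Integrable (fun J => skWeight N β h σ * rexp (linForm (skCoeff N β) J σ))
      (gaussianPi (Fin N × Fin N)) := fun σ => by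
    have : (fun J => rexp (linForm (skCoeff N β) J σ)) =
        fun J => rexp (1 * log (expSum (S := Unit) (fun _ => 1)
          (linForm (fun _ => skCoeff N β σ) J))) := by
      ext J; simp [expSum, linForm]
    rw [integrable_const_mul_iff (by simp [(hw σ).ne']), this]
    exact integrable_exp_mul_log_expSum_linForm (fun _ => one_pos) _ 1
  have hZi : Integrable (fun J => expSum (skWeight N β h) (linForm (skCoeff N β) J))
      (gaussianPi (Fin N × Fin N)) := integrable_finsetSum _ fun σ _ => hterm σ
  have hZ : ∫ J, expSum (skWeight N β h) (linForm (skCoeff N β) J)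
      ∂gaussianPi (Fin N × Fin N) ≤ rexp K := by
    simp only [expSum]
    rw [integral_finsetSum _ fun σ _ => hterm σ]
    have hb : ∀ σ ∈ (Finset.univ : Finset (Fin N → Bool)),
        ∫ J, skWeight N β h σ * rexp (linForm (skCoeff N β) J σ) ∂gaussianPi (Fin N × Fin N) ≤
          rexp (|β * h| * N + β ^ 2 / 2 * N) := fun σ _ => by
      rw [integral_const_mul]
      simp only [linForm]
      rw [integral_exp_sum_gaussianPi, skWeight, ← exp_add, exp_le_exp]
      have h1 : |∑ i, spinVal (σ i)| ≤ N := by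
        refine (Finset.abs_sum_le_sum_abs _ _).trans ?_
        simp [abs_spinVal]
      have h2 : β * h * ∑ i, spinVal (σ i) ≤ |β * h| * N := by
        refine (le_abs_self _).trans ?_
        rw [abs_mul]
        exact mul_le_mul_of_nonneg_left h1 (abs_nonneg _)
      have h3 := sum_skCoeff_sq_le N β σ
      linarith
    refine (Finset.sum_le_card_nsmul _ _ _ hb).trans_eq ?_
    simp only [Finset.card_univ, Fintype.card_fun, Fintype.card_bool, Fintype.card_fin,
      nsmul_eq_mul, Nat.cast_pow, Nat.cast_ofNat]
    rw [hK, add_mul, add_mul, add_assoc, exp_add (log 2 * N), mul_comm (log 2), exp_nat_mul,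
      exp_log two_pos]
  rw [integral_log_skZ]
  have hle : ∀ J, log (expSum (skWeight N β h) (linForm (skCoeff N β) J)) ≤
      rexp (-K) * expSum (skWeight N β h) (linForm (skCoeff N β) J) + (K - 1) := fun J => by
    have hp := expSum_pos hw (linForm (skCoeff N β) J)
    have := log_le_sub_one_of_pos (mul_pos (exp_pos (-K)) hp)
    rw [log_mul (exp_pos _).ne' hp.ne', log_exp] at this
    linarith
  refine (integral_mono (integrable_log_expSum_linForm hw _)
    ((hZi.const_mul _).add (integrable_const _)) hle).trans ?_
  rw [integral_add' (hZi.const_mul _) (integrable_const _), integral_const_mul]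
  have : rexp (-K) * ∫ J, expSum (skWeight N β h) (linForm (skCoeff N β) J)
      ∂gaussianPi (Fin N × Fin N) ≤ 1 := by
    refine (mul_le_mul_of_nonneg_left hZ (exp_pos _).le).trans_eq ?_
    rw [← exp_add]; simp
  simp only [integral_const, probReal_univ, one_smul]
  linarith

lemma mul_skAlpha (N : ℕ) (hN : N ≠ 0) (β h : ℝ) :
    N * skAlpha N β h = ∫ J, log (skZ N β h J) ∂skMuJ N := by
  rw [skAlpha, ← mul_assoc, mul_one_div, div_self (Nat.cast_ne_zero.2 hN), one_mul]

lemma subadditive_neg_mul_skAlpha (β h : ℝ) :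
    Subadditive fun N : ℕ => -(N * skAlpha N β h) := by
  intro m n
  rcases eq_or_ne m 0 with rfl | hm
  · simp
  rcases eq_or_ne n 0 with rfl | hn
  · simp
  change -(((m + n : ℕ) : ℝ) * _) ≤ -(m * _) + -(n * _)
  rw [mul_skAlpha m hm, mul_skAlpha n hn, mul_skAlpha (m + n) (by omega)]
  linarith [integral_log_skZ_add_le hm hn β h]

lemma skAlpha_le (N : ℕ) (β h : ℝ) : skAlpha N β h ≤ log 2 + |β * h| + β ^ 2 / 2 := by
  rcases eq_or_ne N 0 with rfl | hN
  · have : 0 ≤ log 2 := log_nonneg one_le_two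
    simp only [skAlpha, Nat.cast_zero, div_zero, zero_mul]
    positivity
  · have hN' : (0 : ℝ) < N := Nat.cast_pos.2 (Nat.pos_of_ne_zero hN)
    have := integral_log_skZ_le N β h
    rw [← mul_skAlpha N hN, mul_comm] at this
    exact le_of_mul_le_mul_right this hN'

lemma bddAbove_range_skAlpha (β h : ℝ) :
    BddAbove (Set.range fun N : ℕ => skAlpha (N + 1) β h) :=
  ⟨_, Set.forall_mem_range.2 fun N => skAlpha_le (N + 1) β h⟩

lemma tendsto_skAlpha (β h : ℝ) :
    Tendsto (fun N => skAlpha N β h) atTop (𝓝 (⨆ N : ℕ, skAlpha (N + 1) β h)) := by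
  have hsub := subadditive_neg_mul_skAlpha β h
  have hdiv : ∀ N : ℕ, N ≠ 0 → -(N * skAlpha N β h) / N = -skAlpha N β h := fun N hN => by
    have : (N : ℝ) ≠ 0 := Nat.cast_ne_zero.2 hN
    field_simp
  have hbdd : BddBelow (Set.range fun N : ℕ => -(N * skAlpha N β h) / N) := by
    refine ⟨-(log 2 + |β * h| + β ^ 2 / 2), Set.forall_mem_range.2 fun N => ?_⟩
    rcases eq_or_ne N 0 with rfl | hN
    · have : 0 ≤ log 2 := log_nonneg one_le_two
      simp only [Nat.cast_zero, zero_mul, div_zero, Left.neg_nonpos_iff]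
      positivity
    · rw [hdiv N hN]
      exact neg_le_neg (skAlpha_le N β h)
  have hlim : Tendsto (fun N => skAlpha N β h) atTop (𝓝 (-hsub.lim)) := by
    refine (hsub.tendsto_lim hbdd).neg.congr' ?_
    filter_upwards [eventually_ne_atTop 0] with N hN
    rw [hdiv N hN, neg_neg]
  have heq : -hsub.lim = ⨆ N : ℕ, skAlpha (N + 1) β h := by
    refine le_antisymm ?_ (ciSup_le fun N => ?_)
    · exact le_of_tendsto' ((tendsto_add_atTop_iff_nat 1).2 hlim)
        fun N => le_ciSup (bddAbove_range_skAlpha β h) N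
    · have := hsub.lim_le_div hbdd N.succ_ne_zero
      rw [hdiv _ N.succ_ne_zero] at this
      exact le_neg_of_le_neg this
  rwa [← heq]

lemma tendsto_skPhi (N : ℕ) (β h : ℝ) :
    Tendsto (fun n => skPhi N n β h) (𝓝[>] 0) (𝓝 (skAlpha N β h)) := by
  have hw := skWeight_pos N β h
  have hprob : IsProbabilityMeasure (skMuJ N) := by unfold skMuJ; infer_instance
  have hZ : ∀ J, 0 < skZ N β h J := fun J => by rw [skZ_eq_expSum]; exact expSum_pos hw _
  have hset : integrableExpSet (fun J => log (skZ N β h J)) (skMuJ N) = Set.univ := by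
    refine Set.eq_univ_of_forall fun t => ?_
    simpa only [integrableExpSet, Set.mem_ofPred_eq, skZ_eq_expSum, skMuJ] using
      integrable_exp_mul_log_expSum_linForm hw (skCoeff N β) t
  have h0 : (0 : ℝ) ∈ interior (integrableExpSet (fun J => log (skZ N β h J)) (skMuJ N)) := by
    simp [hset]
  have hd := (analyticAt_cgf h0).differentiableAt.hasDerivAt
  rw [deriv_cgf_zero h0] at hd
  have hslope := (hd.tendsto_slope_zero_right).const_mul (1 / (N : ℝ))
  simp only [zero_add, cgf_zero, sub_zero, probReal_univ, div_one] at hslope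
  refine hslope.congr fun n => ?_
  rw [skPhi, cgf, mgf]
  have : ∀ J, skZ N β h J ^ n = rexp (n * log (skZ N β h J)) := fun J => by
    rw [rpow_def_of_pos (hZ J), mul_comm]
  simp only [this, smul_eq_mul]
  ring

/-- the limit `α(β,h) := lim_{N→∞} α_N(β,h)` exists and equals
`sup_{N≥1} α_N(β,h)`; moreover `lim_{N→∞} (lim_{n→0⁺} φ_N(n,β,h)) = α(β,h)`. -/
theorem stmt1 (β h : ℝ) (hβ : 0 < β) :
    Tendsto (fun N => skAlpha N β h) atTop (𝓝 (⨆ N : ℕ, skAlpha (N + 1) β h)) ∧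
    ∀ L : ℕ → ℝ,
      (∀ N, 1 ≤ N → Tendsto (fun n => skPhi N n β h) (𝓝[>] (0:ℝ)) (𝓝 (L N))) →
      Tendsto L atTop (𝓝 (⨆ N : ℕ, skAlpha (N + 1) β h)) := by
  refine ⟨tendsto_skAlpha β h, fun L hL => (tendsto_skAlpha β h).congr' ?_⟩
  filter_upwards [eventually_ge_atTop 1] with N hN
  exact tendsto_nhds_unique (tendsto_skPhi N β h) (hL N hN)
end
end

section
/- For every n ∈ (0,1] and every t ∈ (0,1), the function t ↦ φ(n,t) = n^{−1} log E[Z_t^n] is differentiable and (d/dt) φ(n,t) = (1/2) ⟨ ω_t(i ↦ S_{ii}) ⟩_{n,t} + ((n−1)/2) ⟨ Ω_t(S) ⟩_{n,t}. -/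
open MeasureTheory ProbabilityTheory Real Filter Topology

noncomputable section

/-- Law of `M` i.i.d. standard Gaussians. -/
def gMu (M : ℕ) : Measure (Fin M → ℝ) := Measure.pi fun _ => gaussianReal 0 1

/-- The centered Gaussian family `U_i = Σ_k A_{ik} g_k`. -/
def gU {N M : ℕ} (A : Matrix (Fin N) (Fin M) ℝ) (i : Fin N) (g : Fin M → ℝ) : ℝ :=
  ∑ k, A i k * g k

/-- Covariance matrix `S = A Aᵀ`, i.e. `S_{ij} = E[U_i U_j]`. -/
def gS {N M : ℕ} (A : Matrix (Fin N) (Fin M) ℝ) (i j : Fin N) : ℝ :=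
  ∑ k, A i k * A j k

/-- Interpolating partition function `Z_t = Σ_i w_i exp(√t U_i)`. -/
def gZ {N M : ℕ} (w : Fin N → ℝ) (A : Matrix (Fin N) (Fin M) ℝ) (t : ℝ)
    (g : Fin M → ℝ) : ℝ :=
  ∑ i, w i * Real.exp (Real.sqrt t * gU A i g)

/-- Gibbs weight `p_i(t) = w_i exp(√t U_i)/Z_t`. -/
def gP {N M : ℕ} (w : Fin N → ℝ) (A : Matrix (Fin N) (Fin M) ℝ) (t : ℝ)
    (g : Fin M → ℝ) (i : Fin N) : ℝ :=
  w i * Real.exp (Real.sqrt t * gU A i g) / gZ w A t g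

/-- Deformed quenched average `⟨X⟩_{n,t} = E[Z_t^n X]/E[Z_t^n]`. -/
def gAvg {N M : ℕ} (w : Fin N → ℝ) (A : Matrix (Fin N) (Fin M) ℝ) (n t : ℝ)
    (X : (Fin M → ℝ) → ℝ) : ℝ :=
  (∫ g, gZ w A t g ^ n * X g ∂ gMu M) / (∫ g, gZ w A t g ^ n ∂ gMu M)

/-- `φ(n,t) = n⁻¹ log E[Z_t^n]`. -/
def gPhi {N M : ℕ} (w : Fin N → ℝ) (A : Matrix (Fin N) (Fin M) ℝ) (n t : ℝ) : ℝ :=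
  n⁻¹ * Real.log (∫ g, gZ w A t g ^ n ∂ gMu M)

/-- Gaussian integration by parts in one variable. -/
theorem integral_id_mul_gaussianReal_s2 {f f' : ℝ → ℝ} (hd : ∀ x, HasDerivAt f (f' x) x)
    (hf : Integrable f (gaussianReal 0 1)) (hxf : Integrable (fun x => x * f x) (gaussianReal 0 1))
    (hf' : Integrable f' (gaussianReal 0 1)) :
    ∫ x, x * f x ∂gaussianReal 0 1 = ∫ x, f' x ∂gaussianReal 0 1 := by
  have key : ∀ {h : ℝ → ℝ}, Integrable h (gaussianReal 0 1) →
      Integrable (fun x => h x * gaussianPDFReal 0 1 x) := by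
    intro h hh
    rw [gaussianReal_of_var_ne_zero _ one_ne_zero,
      integrable_withDensity_iff_integrable_smul' (measurable_gaussianPDF _ _)
        (Eventually.of_forall fun _ => gaussianPDF_lt_top)] at hh
    simpa [toReal_gaussianPDF, mul_comm] using hh
  have hv : ∀ x, HasDerivAt (gaussianPDFReal 0 1) (-(x * gaussianPDFReal 0 1 x)) x := by
    intro x
    have h1 : HasDerivAt (fun y : ℝ => -(y - 0) ^ 2 / (2 * ((1 : NNReal) : ℝ))) (-x) x := by
      have := ((((hasDerivAt_id x).sub_const 0).pow 2).neg).div_const (2 * ((1 : NNReal) : ℝ))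
      refine this.congr_deriv ?_
      simp
      ring
    have h2 := h1.exp.const_mul (√(2 * π * ((1 : NNReal) : ℝ)))⁻¹
    rw [gaussianPDFReal_def]
    refine h2.congr_deriv ?_
    ring
  have hibp := integral_mul_deriv_eq_deriv_mul_of_integrable (u := f) (u' := f')
    (v := gaussianPDFReal 0 1) (v' := fun x => -(x * gaussianPDFReal 0 1 x))
    (fun x _ => hd x) (fun x _ => hv x)
    ((key hxf).neg.congr (Eventually.of_forall fun x => by simp; ring)) (key hf') (key hf)
  rw [integral_gaussianReal_eq_integral_smul one_ne_zero,
    integral_gaussianReal_eq_integral_smul one_ne_zero]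
  simp only [smul_eq_mul]
  have e : ∀ x, f x * -(x * gaussianPDFReal 0 1 x) = -(gaussianPDFReal 0 1 x * (x * f x)) :=
    fun x => by ring
  simp only [e, integral_neg, neg_inj] at hibp
  rw [hibp]
  exact integral_congr_ae (Eventually.of_forall fun x => mul_comm _ _)

/-- Gaussian integration by parts in one coordinate of a standard Gaussian vector. -/
theorem integral_eval_mul_gMu {m : ℕ} (k : Fin (m + 1)) {F F' : (Fin (m + 1) → ℝ) → ℝ}
    (hd : ∀ g, HasDerivAt (fun x => F (Function.update g k x)) (F' g) (g k))
    (hF : Integrable F (gMu (m + 1))) (hgF : Integrable (fun g => g k * F g) (gMu (m + 1)))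
    (hF' : Integrable F' (gMu (m + 1))) :
    ∫ g, g k * F g ∂gMu (m + 1) = ∫ g, F' g ∂gMu (m + 1) := by
  have hmp := (measurePreserving_piFinSuccAbove
    (fun _ : Fin (m + 1) => gaussianReal 0 1) k).symm
  have hint : ∀ {G : (Fin (m + 1) → ℝ) → ℝ}, Integrable G (gMu (m + 1)) →
      Integrable (fun p : ℝ × (Fin m → ℝ) => G (k.insertNth p.1 p.2))
        ((gaussianReal 0 1).prod (Measure.pi fun _ => gaussianReal 0 1)) := by
    intro G hG
    exact (hmp.integrable_comp_emb (MeasurableEquiv.measurableEmbedding _)).2 hG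
  have hval : ∀ {G : (Fin (m + 1) → ℝ) → ℝ}, Integrable G (gMu (m + 1)) →
      ∫ g, G g ∂gMu (m + 1) = ∫ h : Fin m → ℝ, ∫ x, G (k.insertNth x h) ∂gaussianReal 0 1
        ∂(Measure.pi fun _ => gaussianReal 0 1) := by
    intro G hG
    rw [← integral_prod_symm _ (hint hG)]
    exact (hmp.integral_comp' G).symm
  rw [hval hgF, hval hF']
  refine integral_congr_ae ?_
  filter_upwards [(hint hF).prod_left_ae, (hint hgF).prod_left_ae, (hint hF').prod_left_ae]
    with h h1 h2 h3
  simp only [Fin.insertNth_apply_same] at h2 ⊢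
  refine integral_id_mul_gaussianReal_s2 (fun x => ?_) h1 h2 h3
  simpa [Fin.update_insertNth] using hd (k.insertNth x h)

theorem integrable_exp_sum_abs_gMu {M : ℕ} (c : ℝ) :
    Integrable (fun g : Fin M → ℝ => Real.exp (c * ∑ k, |g k|)) (gMu M) := by
  have h := Integrable.fintype_prod (ι := Fin M) (μ := fun _ => gaussianReal 0 1)
    (f := fun _ x => Real.exp (c * |x|)) fun _ => by
      exact integrable_exp_mul_abs (X := fun x : ℝ => x) (integrable_exp_mul_gaussianReal c)
        (integrable_exp_mul_gaussianReal (-c))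
  simp only [← Real.exp_sum, ← Finset.mul_sum] at h
  exact h

theorem integrable_gMu_of_abs_le_exp {M : ℕ} {f : (Fin M → ℝ) → ℝ} (hf : Continuous f) {C c : ℝ}
    (h : ∀ g, |f g| ≤ C * Real.exp (c * ∑ k, |g k|)) : Integrable f (gMu M) :=
  ((integrable_exp_sum_abs_gMu c).const_mul C).mono' hf.aestronglyMeasurable
    (Eventually.of_forall h)

section Gibbs

variable {N M : ℕ} {w : Fin N → ℝ} (A : Matrix (Fin N) (Fin M) ℝ)

theorem continuous_gU (i : Fin N) : Continuous (gU A i) := by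
  unfold gU
  fun_prop

theorem continuous_gZ (s : ℝ) : Continuous (gZ w A s) := by
  unfold gZ
  have := continuous_gU A
  fun_prop

theorem abs_gU_le (i : Fin N) (g : Fin M → ℝ) :
    |gU A i g| ≤ (∑ i, ∑ k, |A i k|) * ∑ k, |g k| := by
  calc |gU A i g| ≤ ∑ k, |A i k| * |g k| := by
        simpa only [gU, abs_mul] using Finset.abs_sum_le_sum_abs (fun k => A i k * g k) Finset.univ
    _ ≤ ∑ k, (∑ i, ∑ k, |A i k|) * |g k| := by
        gcongr with k
        exact (Finset.single_le_sum (f := fun k => |A i k|) (fun _ _ => abs_nonneg _)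
          (Finset.mem_univ k)).trans
          (Finset.single_le_sum (f := fun i => ∑ k, |A i k|)
            (fun _ _ => Finset.sum_nonneg fun _ _ => abs_nonneg _) (Finset.mem_univ i))
    _ = _ := by rw [Finset.mul_sum]

theorem gZ_pos (hN : 1 ≤ N) (hw : ∀ i, 0 < w i) (s : ℝ) (g : Fin M → ℝ) : 0 < gZ w A s g :=
  Finset.sum_pos (fun i _ => mul_pos (hw i) (Real.exp_pos _)) ⟨⟨0, hN⟩, Finset.mem_univ _⟩

theorem gP_nonneg (hN : 1 ≤ N) (hw : ∀ i, 0 < w i) (s : ℝ) (g : Fin M → ℝ) (i : Fin N) :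
    0 ≤ gP w A s g i :=
  div_nonneg (mul_nonneg (hw i).le (Real.exp_pos _).le) (gZ_pos A hN hw s g).le

theorem sum_gP (hN : 1 ≤ N) (hw : ∀ i, 0 < w i) (s : ℝ) (g : Fin M → ℝ) :
    ∑ i, gP w A s g i = 1 := by
  simp only [gP, ← Finset.sum_div]
  exact div_self (gZ_pos A hN hw s g).ne'

theorem gP_le_one (hN : 1 ≤ N) (hw : ∀ i, 0 < w i) (s : ℝ) (g : Fin M → ℝ) (i : Fin N) :
    gP w A s g i ≤ 1 := by
  rw [← sum_gP A hN hw s g]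
  exact Finset.single_le_sum (fun j _ => gP_nonneg A hN hw s g j) (Finset.mem_univ i)

theorem continuous_gP (hN : 1 ≤ N) (hw : ∀ i, 0 < w i) (s : ℝ) (i : Fin N) :
    Continuous (fun g : Fin M → ℝ => gP w A s g i) := by
  unfold gP
  have h1 := continuous_gU A i
  have h2 := continuous_gZ (w := w) A s
  exact Continuous.div (by fun_prop) h2 fun g => (gZ_pos A hN hw s g).ne'

theorem continuous_gZ_rpow (hN : 1 ≤ N) (hw : ∀ i, 0 < w i) (n s : ℝ) :
    Continuous (fun g : Fin M → ℝ => gZ w A s g ^ n) :=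
  (continuous_gZ A s).rpow_const fun g => Or.inl (gZ_pos A hN hw s g).ne'

theorem gZ_rpow_le (hN : 1 ≤ N) (hw : ∀ i, 0 < w i) {n s : ℝ} (hn : n ∈ Set.Ioc (0 : ℝ) 1)
    (hs : s ≤ 1) (g : Fin M → ℝ) :
    gZ w A s g ^ n ≤ (1 + ∑ i, w i) * Real.exp ((∑ i, ∑ k, |A i k|) * ∑ k, |g k|) := by
  set a := ∑ i, ∑ k, |A i k|
  have ha : 0 ≤ a := Finset.sum_nonneg fun _ _ => Finset.sum_nonneg fun _ _ => abs_nonneg _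
  have hG : 0 ≤ ∑ k, |g k| := Finset.sum_nonneg fun _ _ => abs_nonneg _
  have hZ : gZ w A s g ≤ (∑ i, w i) * Real.exp (a * ∑ k, |g k|) := by
    rw [Finset.sum_mul]
    refine Finset.sum_le_sum fun i _ => ?_
    refine mul_le_mul_of_nonneg_left (Real.exp_le_exp.2 ?_) (hw i).le
    calc √s * gU A i g ≤ √s * |gU A i g| := by gcongr; exact le_abs_self _
      _ ≤ 1 * (a * ∑ k, |g k|) := by
        gcongr
        · exact Real.sqrt_le_one.2 hs
        · exact abs_gU_le A i g
      _ = _ := one_mul _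
  have hZ0 := gZ_pos A hN hw s g
  have h1 : gZ w A s g ^ n ≤ 1 + gZ w A s g := by
    calc gZ w A s g ^ n ≤ (1 + gZ w A s g) ^ n := by
          refine Real.rpow_le_rpow hZ0.le (by linarith) hn.1.le
      _ ≤ (1 + gZ w A s g) ^ (1 : ℝ) := Real.rpow_le_rpow_of_exponent_le (by linarith) hn.2
      _ = _ := Real.rpow_one _
  have h2 : 1 ≤ Real.exp (a * ∑ k, |g k|) := Real.one_le_exp (by positivity)
  linarith

theorem integrable_gZ_rpow_mul (hN : 1 ≤ N) (hw : ∀ i, 0 < w i) {n s : ℝ}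
    (hn : n ∈ Set.Ioc (0 : ℝ) 1) (hs : s ≤ 1) {X : (Fin M → ℝ) → ℝ} (hX : Continuous X) {C c : ℝ}
    (hXb : ∀ g, |X g| ≤ C * Real.exp (c * ∑ k, |g k|)) :
    Integrable (fun g => gZ w A s g ^ n * X g) (gMu M) := by
  refine integrable_gMu_of_abs_le_exp ((continuous_gZ_rpow A hN hw n s).mul hX)
    (C := (1 + ∑ i, w i) * C) (c := (∑ i, ∑ k, |A i k|) + c) fun g => ?_
  have h0 : 0 ≤ gZ w A s g ^ n := Real.rpow_nonneg (gZ_pos A hN hw s g).le _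
  have h1 := gZ_rpow_le A hN hw hn hs g
  rw [abs_mul, abs_of_nonneg h0, add_mul (∑ i, ∑ k, |A i k|) c, Real.exp_add]
  calc _ ≤ _ := mul_le_mul h1 (hXb g) (abs_nonneg _) (h0.trans h1)
    _ = _ := by ring

theorem integrable_gZ_rpow_mul_of_bounded (hN : 1 ≤ N) (hw : ∀ i, 0 < w i) {n s : ℝ}
    (hn : n ∈ Set.Ioc (0 : ℝ) 1) (hs : s ≤ 1) {X : (Fin M → ℝ) → ℝ} (hX : Continuous X) {C : ℝ}
    (hXb : ∀ g, |X g| ≤ C) :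
    Integrable (fun g => gZ w A s g ^ n * X g) (gMu M) :=
  integrable_gZ_rpow_mul A hN hw hn hs hX (C := C) (c := 0) fun g => by simpa using hXb g

instance (M : ℕ) : IsProbabilityMeasure (gMu M) := by
  unfold gMu
  infer_instance

theorem integral_gZ_rpow_pos (hN : 1 ≤ N) (hw : ∀ i, 0 < w i) {n s : ℝ}
    (hn : n ∈ Set.Ioc (0 : ℝ) 1) (hs : s ≤ 1) : 0 < ∫ g, gZ w A s g ^ n ∂gMu M := by
  have hint : Integrable (fun g => gZ w A s g ^ n) (gMu M) := by
    simpa using integrable_gZ_rpow_mul_of_bounded A hN hw hn hs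
      (continuous_const (y := (1 : ℝ))) (C := 1) (by simp)
  have hpos : ∀ g : Fin M → ℝ, 0 < gZ w A s g ^ n :=
    fun g => Real.rpow_pos_of_pos (gZ_pos A hN hw s g) _
  rw [integral_pos_iff_support_of_nonneg (fun g => (hpos g).le) hint]
  have : Function.support (fun g : Fin M → ℝ => gZ w A s g ^ n) = Set.univ :=
    Set.eq_univ_of_forall fun g => (hpos g).ne'
  simp [this]

theorem hasDerivAt_gU_update (i : Fin N) (g : Fin M → ℝ) (k : Fin M) :
    HasDerivAt (fun x => gU A i (Function.update g k x)) (A i k) (g k) := by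
  unfold gU
  have h : ∀ l ∈ Finset.univ, HasDerivAt (fun x => A i l * Function.update g k x l)
      (if l = k then A i k else 0) (g k) := by
    intro l _
    by_cases hl : l = k
    · subst hl
      simpa using (hasDerivAt_id (g l)).const_mul (A i l)
    · simpa [hl] using hasDerivAt_const (g k) (A i l * g l)
  simpa using HasDerivAt.fun_sum h

theorem hasDerivAt_gZ_rpow_mul_gP_update (hN : 1 ≤ N) (hw : ∀ i, 0 < w i) (n s : ℝ) (i : Fin N)
    (g : Fin M → ℝ) (k : Fin M) :
    HasDerivAt (fun x => gZ w A s (Function.update g k x) ^ n * gP w A s (Function.update g k x) i)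
      (gZ w A s g ^ n * (√s * gP w A s g i * (A i k + (n - 1) * ∑ j, gP w A s g j * A j k)))
      (g k) := by
  have he : ∀ j, HasDerivAt (fun x => w j * Real.exp (√s * gU A j (Function.update g k x)))
      (w j * (Real.exp (√s * gU A j g) * (√s * A j k))) (g k) := by
    intro j
    simpa using ((((hasDerivAt_gU_update A j g k).const_mul √s).exp).const_mul (w j))
  have hZ : HasDerivAt (fun x => gZ w A s (Function.update g k x))
      (gZ w A s g * (√s * ∑ j, gP w A s g j * A j k)) (g k) := by
    refine (HasDerivAt.fun_sum fun j (_ : j ∈ Finset.univ) => he j).congr_deriv ?_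
    have := (gZ_pos A hN hw s g).ne'
    simp only [gP, Finset.mul_sum]
    refine Finset.sum_congr rfl fun j _ => ?_
    field_simp
  have hZ0 : gZ w A s (Function.update g k (g k)) ≠ 0 := (gZ_pos A hN hw s _).ne'
  have h := (hZ.rpow_const (p := n) (Or.inl hZ0)).mul ((he i).div hZ hZ0)
  refine h.congr_deriv ?_
  have hp := gZ_pos A hN hw s g
  simp only [Function.update_eq_self, Pi.div_apply, Real.rpow_sub_one hp.ne']
  set B := ∑ j, gP w A s g j * A j k
  simp only [gP]
  field_simp
  ring

theorem hasDerivAt_gZ_rpow (hN : 1 ≤ N) (hw : ∀ i, 0 < w i) (n : ℝ) {s : ℝ} (hs : 0 < s)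
    (g : Fin M → ℝ) :
    HasDerivAt (fun s => gZ w A s g ^ n)
      (gZ w A s g ^ n * (n / (2 * √s) * ∑ i, gP w A s g i * gU A i g)) s := by
  have hZ : HasDerivAt (fun s => gZ w A s g)
      (gZ w A s g * (1 / (2 * √s) * ∑ i, gP w A s g i * gU A i g)) s := by
    refine (HasDerivAt.fun_sum fun j (_ : j ∈ Finset.univ) =>
      ((((Real.hasDerivAt_sqrt hs.ne').mul_const (gU A j g)).exp).const_mul (w j))).congr_deriv ?_
    have := (gZ_pos A hN hw s g).ne'
    simp only [gP, Finset.mul_sum]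
    refine Finset.sum_congr rfl fun j _ => ?_
    field_simp
  have hp := gZ_pos A hN hw s g
  refine (hZ.rpow_const (p := n) (Or.inl hp.ne')).congr_deriv ?_
  rw [Real.rpow_sub_one hp.ne']
  field_simp

theorem abs_sum_gP_mul_gU_le (hN : 1 ≤ N) (hw : ∀ i, 0 < w i) (s : ℝ) (g : Fin M → ℝ) :
    |∑ i, gP w A s g i * gU A i g| ≤ Real.exp ((∑ i, ∑ k, |A i k|) * ∑ k, |g k|) := by
  calc |∑ i, gP w A s g i * gU A i g| ≤ ∑ i, |gP w A s g i * gU A i g| :=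
        Finset.abs_sum_le_sum_abs _ _
    _ ≤ ∑ i, gP w A s g i * ((∑ i, ∑ k, |A i k|) * ∑ k, |g k|) := by
        refine Finset.sum_le_sum fun i _ => ?_
        rw [abs_mul, abs_of_nonneg (gP_nonneg A hN hw s g i)]
        exact mul_le_mul_of_nonneg_left (abs_gU_le A i g) (gP_nonneg A hN hw s g i)
    _ = (∑ i, ∑ k, |A i k|) * ∑ k, |g k| := by rw [← Finset.sum_mul, sum_gP A hN hw, one_mul]
    _ ≤ _ := by linarith [Real.add_one_le_exp ((∑ i, ∑ k, |A i k|) * ∑ k, |g k|)]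

theorem hasDerivAt_integral_gZ_rpow (hN : 1 ≤ N) (hw : ∀ i, 0 < w i) {n t : ℝ}
    (hn : n ∈ Set.Ioc (0 : ℝ) 1) (ht : t ∈ Set.Ioo (0 : ℝ) 1) :
    HasDerivAt (fun s => ∫ g, gZ w A s g ^ n ∂gMu M)
      (∫ g, gZ w A t g ^ n * (n / (2 * √t) * ∑ i, gP w A t g i * gU A i g) ∂gMu M) t := by
  have ht0 := ht.1
  have hU := continuous_gU A
  have hP := continuous_gP (w := w) A hN hw t
  refine (hasDerivAt_integral_of_dominated_loc_of_deriv_le (s := Set.Ioo (t / 2) 1)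
    (F' := fun s g => gZ w A s g ^ n * (n / (2 * √s) * ∑ i, gP w A s g i * gU A i g))
    (bound := fun g => (1 + ∑ i, w i) * (n / (2 * √(t / 2))) *
      Real.exp ((2 * ∑ i, ∑ k, |A i k|) * ∑ k, |g k|))
    (Ioo_mem_nhds (by linarith) ht.2) ?_ ?_ ?_ ?_ ?_ ?_).2
  · exact Eventually.of_forall fun s => (continuous_gZ_rpow A hN hw n s).aestronglyMeasurable
  · simpa using integrable_gZ_rpow_mul_of_bounded A hN hw hn ht.2.le
      (continuous_const (y := (1 : ℝ))) (C := 1) (by simp)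
  · have := continuous_gZ_rpow A hN hw n t
    exact Continuous.aestronglyMeasurable (by fun_prop)
  · refine Eventually.of_forall fun g s hs => ?_
    have hn0 := hn.1
    have h0 : 0 ≤ gZ w A s g ^ n := Real.rpow_nonneg (gZ_pos A hN hw s g).le _
    have h1 := gZ_rpow_le A hN hw hn hs.2.le g
    have h2 := abs_sum_gP_mul_gU_le A hN hw s g
    have h3 : n / (2 * √s) ≤ n / (2 * √(t / 2)) := by
      have : 0 < √(t / 2) := Real.sqrt_pos.2 (by linarith)
      gcongr
      exact hs.1.le
    have h4 : 0 ≤ n / (2 * √s) := by positivity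
    rw [Real.norm_eq_abs, abs_mul, abs_mul, abs_of_nonneg h0, abs_of_nonneg h4]
    calc _ ≤ _ := mul_le_mul h1 (mul_le_mul h3 h2 (abs_nonneg _) (h4.trans h3))
            (by positivity) (h0.trans h1)
      _ = _ := by
        rw [mul_assoc 2 _ (∑ k, |g k|), two_mul (_ * ∑ k, |g k|), Real.exp_add]
        ring
  · exact (integrable_exp_sum_abs_gMu _).const_mul _
  · exact Eventually.of_forall fun g s hs =>
      hasDerivAt_gZ_rpow A hN hw n ((half_pos ht0).trans hs.1) g

theorem abs_sum_gP_mul_le (hN : 1 ≤ N) (hw : ∀ i, 0 < w i) (s : ℝ) (g : Fin M → ℝ)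
    (x : Fin N → ℝ) : |∑ i, gP w A s g i * x i| ≤ ∑ i, |x i| := by
  refine (Finset.abs_sum_le_sum_abs _ _).trans (Finset.sum_le_sum fun i _ => ?_)
  rw [abs_mul, abs_of_nonneg (gP_nonneg A hN hw s g i)]
  exact mul_le_of_le_one_left (abs_nonneg _) (gP_le_one A hN hw s g i)

end Gibbs

theorem integrable_eval_mul_gZ_rpow_mul_gP {N M : ℕ} {w : Fin N → ℝ}
    (A : Matrix (Fin N) (Fin M) ℝ) (hN : 1 ≤ N) (hw : ∀ i, 0 < w i) {n t : ℝ}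
    (hn : n ∈ Set.Ioc (0 : ℝ) 1) (ht : t ≤ 1) (i : Fin N) (k : Fin M) :
    Integrable (fun g => g k * (gZ w A t g ^ n * gP w A t g i)) (gMu M) := by
  have hP := continuous_gP (w := w) A hN hw t i
  have := integrable_gZ_rpow_mul A hN hw hn ht (X := fun g => g k * gP w A t g i)
    (by fun_prop) (C := 1) (c := 1) fun g => by
      rw [abs_mul, abs_of_nonneg (gP_nonneg A hN hw t g i), one_mul, one_mul]
      have h1 : |g k| ≤ ∑ k, |g k| :=
        Finset.single_le_sum (f := fun k => |g k|) (fun _ _ => abs_nonneg _) (Finset.mem_univ k)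
      calc _ ≤ |g k| := mul_le_of_le_one_right (abs_nonneg _) (gP_le_one A hN hw t g i)
        _ ≤ _ := by linarith [Real.add_one_le_exp (∑ k, |g k|)]
  exact this.congr (Eventually.of_forall fun g => by ring)

theorem integral_eval_mul_gZ_rpow_mul_gP {N m : ℕ} {w : Fin N → ℝ}
    (A : Matrix (Fin N) (Fin (m + 1)) ℝ) (hN : 1 ≤ N) (hw : ∀ i, 0 < w i) {n t : ℝ}
    (hn : n ∈ Set.Ioc (0 : ℝ) 1) (ht : t ≤ 1) (i : Fin N) (k : Fin (m + 1)) :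
    Integrable (fun g => gZ w A t g ^ n *
        (√t * gP w A t g i * (A i k + (n - 1) * ∑ j, gP w A t g j * A j k))) (gMu (m + 1)) ∧
    ∫ g, g k * (gZ w A t g ^ n * gP w A t g i) ∂gMu (m + 1) =
      ∫ g, gZ w A t g ^ n *
        (√t * gP w A t g i * (A i k + (n - 1) * ∑ j, gP w A t g j * A j k)) ∂gMu (m + 1) := by
  have hP := continuous_gP (w := w) A hN hw t
  have hint : Integrable (fun g => gZ w A t g ^ n *
      (√t * gP w A t g i * (A i k + (n - 1) * ∑ j, gP w A t g j * A j k))) (gMu (m + 1)) := by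
    refine integrable_gZ_rpow_mul_of_bounded A hN hw hn ht (by fun_prop)
      (C := √t * 1 * (|A i k| + |n - 1| * ∑ j, |A j k|)) fun g => ?_
    rw [abs_mul, abs_mul, abs_of_nonneg (Real.sqrt_nonneg _),
      abs_of_nonneg (gP_nonneg A hN hw t g i)]
    gcongr
    · exact gP_le_one A hN hw t g i
    · refine (abs_add_le _ _).trans ?_
      rw [abs_mul]
      gcongr
      exact abs_sum_gP_mul_le A hN hw t g fun j => A j k
  refine ⟨hint, integral_eval_mul_gMu k (hasDerivAt_gZ_rpow_mul_gP_update A hN hw n t i · k) ?_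
    (integrable_eval_mul_gZ_rpow_mul_gP A hN hw hn ht i k) hint⟩
  refine integrable_gZ_rpow_mul_of_bounded A hN hw hn ht (hP i) (C := 1) fun g => ?_
  rw [abs_of_nonneg (gP_nonneg A hN hw t g i)]
  exact gP_le_one A hN hw t g i

theorem integral_gZ_rpow_mul_sum_gP_mul_gU {N M : ℕ} {w : Fin N → ℝ}
    (A : Matrix (Fin N) (Fin M) ℝ) (hN : 1 ≤ N) (hM : 1 ≤ M) (hw : ∀ i, 0 < w i) {n t : ℝ}
    (hn : n ∈ Set.Ioc (0 : ℝ) 1) (ht : t ∈ Set.Ioo (0 : ℝ) 1) :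
    ∫ g, gZ w A t g ^ n * (n / (2 * √t) * ∑ i, gP w A t g i * gU A i g) ∂gMu M =
      n / 2 * ((∫ g, gZ w A t g ^ n * ∑ i, gP w A t g i * gS A i i ∂gMu M) +
        (n - 1) * ∫ g, gZ w A t g ^ n *
          ∑ i, ∑ j, gP w A t g i * gP w A t g j * gS A i j ∂gMu M) := by
  obtain ⟨m, rfl⟩ : ∃ m, M = m + 1 := ⟨M - 1, by omega⟩
  have hP := continuous_gP (w := w) A hN hw t
  have hst : √t ≠ 0 := (Real.sqrt_pos.2 ht.1).ne'
  have hibp := integral_eval_mul_gZ_rpow_mul_gP A hN hw hn ht.2.le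
  have hleft := integrable_eval_mul_gZ_rpow_mul_gP A hN hw hn ht.2.le
  have hS1 : Integrable (fun g => gZ w A t g ^ n * ∑ i, gP w A t g i * gS A i i) (gMu (m + 1)) :=
    integrable_gZ_rpow_mul_of_bounded A hN hw hn ht.2.le (by fun_prop)
      fun g => abs_sum_gP_mul_le A hN hw t g fun i => gS A i i
  have hS2 : Integrable (fun g => gZ w A t g ^ n *
      ∑ i, ∑ j, gP w A t g i * gP w A t g j * gS A i j) (gMu (m + 1)) := by
    refine integrable_gZ_rpow_mul_of_bounded A hN hw hn ht.2.le (by fun_prop)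
      (C := ∑ i, ∑ j, |gS A i j|) fun g => ?_
    simp only [mul_assoc, ← Finset.mul_sum]
    exact (abs_sum_gP_mul_le A hN hw t g _).trans
      (Finset.sum_le_sum fun i _ => abs_sum_gP_mul_le A hN hw t g _)
  calc _ = ∫ g, ∑ i, ∑ k, n / (2 * √t) * A i k * (g k * (gZ w A t g ^ n * gP w A t g i))
          ∂gMu (m + 1) := by
        refine integral_congr_ae (Eventually.of_forall fun g => ?_)
        simp only [gU, Finset.mul_sum]
        exact Finset.sum_congr rfl fun i _ => Finset.sum_congr rfl fun k _ => by ring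
    _ = ∑ i, ∑ k, n / (2 * √t) * A i k * ∫ g, gZ w A t g ^ n *
          (√t * gP w A t g i * (A i k + (n - 1) * ∑ j, gP w A t g j * A j k)) ∂gMu (m + 1) := by
        rw [integral_finsetSum _ fun i _ => integrable_finsetSum _ fun k _ =>
          (hleft i k).const_mul _]
        refine Finset.sum_congr rfl fun i _ => ?_
        rw [integral_finsetSum _ fun k _ => (hleft i k).const_mul _]
        refine Finset.sum_congr rfl fun k _ => ?_
        rw [integral_const_mul, (hibp i k).2]
    _ = ∫ g, ∑ i, ∑ k, n / (2 * √t) * A i k * (gZ w A t g ^ n *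
          (√t * gP w A t g i * (A i k + (n - 1) * ∑ j, gP w A t g j * A j k))) ∂gMu (m + 1) := by
        rw [integral_finsetSum _ fun i _ => integrable_finsetSum _ fun k _ =>
          ((hibp i k).1).const_mul _]
        refine Finset.sum_congr rfl fun i _ => ?_
        rw [integral_finsetSum _ fun k _ => ((hibp i k).1).const_mul _]
        exact Finset.sum_congr rfl fun k _ => (integral_const_mul _ _).symm
    _ = ∫ g, n / 2 * (gZ w A t g ^ n * (∑ i, gP w A t g i * gS A i i) +
          (n - 1) * (gZ w A t g ^ n * ∑ i, ∑ j, gP w A t g i * gP w A t g j * gS A i j))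
          ∂gMu (m + 1) := by
        refine integral_congr_ae (Eventually.of_forall fun g => ?_)
        simp only [gS, Finset.mul_sum, ← Finset.sum_add_distrib]
        refine Finset.sum_congr rfl fun i _ => ?_
        rw [Finset.sum_comm (s := (Finset.univ : Finset (Fin N))), ← Finset.sum_add_distrib,
          Finset.mul_sum]
        refine Finset.sum_congr rfl fun k _ => ?_
        simp only [mul_add, Finset.mul_sum]
        congr 1
        · field_simp
        · refine Finset.sum_congr rfl fun j _ => ?_
          field_simp
    _ = _ := by
        rw [integral_const_mul, integral_add hS1 (hS2.const_mul _), integral_const_mul]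

/-- for `n ∈ (0,1]` and `t ∈ (0,1)`, `t ↦ φ(n,t)` is differentiable with
`(d/dt) φ(n,t) = ½ ⟨ω_t(i ↦ S_{ii})⟩_{n,t} + ((n-1)/2) ⟨Ω_t(S)⟩_{n,t}`. -/
theorem stmt2 {N M : ℕ} (hN : 1 ≤ N) (hM : 1 ≤ M)
    (w : Fin N → ℝ) (hw : ∀ i, 0 < w i) (A : Matrix (Fin N) (Fin M) ℝ)
    (n t : ℝ) (hn : n ∈ Set.Ioc (0:ℝ) 1) (ht : t ∈ Set.Ioo (0:ℝ) 1) :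
    HasDerivAt (fun s => gPhi w A n s)
      ((1/2) * gAvg w A n t (fun g => ∑ i, gP w A t g i * gS A i i) +
        ((n - 1)/2) * gAvg w A n t
          (fun g => ∑ i, ∑ j, gP w A t g i * gP w A t g j * gS A i j)) t := by
  have hpos := integral_gZ_rpow_pos A hN hw hn ht.2.le
  have h := ((hasDerivAt_integral_gZ_rpow A hN hw hn ht).log hpos.ne').const_mul n⁻¹
  refine h.congr_deriv ?_
  rw [integral_gZ_rpow_mul_sum_gP_mul_gU A hN hM hw hn ht]
  have hn0 := hn.1.ne'
  simp only [gAvg]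
  field_simp
end
end
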